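/- Let X be a set of variables with ordered partition π = (X_1,…,X_n), each X_i linearly ordered with order type at most ω, and bounds e_i = (e_{i,1}, e_{i,2}, …), e_{i,j} ∈ ℙ ∪ {∞}, satisfying e_{i,1} ≥ e_{i,2} ≥ ⋯ for every i ∈ [n]. Let a ∈ ℙ^n and let f = {f_b}_{b ≤ a} be an array of integers. Then f is the fine f-vector of a finite colored multicomplex of type a in M_π(e_1,…,e_n) if and only if f is the fine f-vector of a color-compressed finite colored multicomplex of type a in M_π(e_1,…,e_n). -/

import Mathlib

open Finset

/-- Monomials in the variables `x_{i,j}` (`i : Fin n` a color, `j : ℕ` a position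
within the `i`-th linearly ordered block), as finitely supported exponent vectors. -/
abbrev MCMon (n : ℕ) : Type := (Fin n × ℕ) →₀ ℕ

/-- Total degree of a monomial. -/
def totalDeg {n : ℕ} (m : MCMon n) : ℕ := ∑ v ∈ m.support, m v

/-- Degree of the restriction of `m` to the variables of color `t`. -/
def degOn {n : ℕ} (t : Fin n) (m : MCMon n) : ℕ :=
  ∑ v ∈ m.support, if v.1 = t then m v else 0

/-- `M` is a multicomplex: a nonempty set of monomials closed under divisibility. -/
def IsMulticomplex {n : ℕ} (M : Set (MCMon n)) : Prop :=
  M.Nonempty ∧ ∀ m ∈ M, ∀ m' : MCMon n, (∀ v, m' v ≤ m v) → m' ∈ M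

/-- `m` is a member of `𝓜_π(e₁,…,eₙ)`: each variable `x_{i,j}` occurring in `m`
exists (i.e. `j ∈ S i`) and the exponents respect the bounds `e`. -/
def InBounds {n : ℕ} (S : Fin n → Set ℕ) (e : Fin n → ℕ → ℕ∞) (m : MCMon n) : Prop :=
  ∀ (i : Fin n) (j : ℕ), m (i, j) ≠ 0 → j ∈ S i ∧ (m (i, j) : ℕ∞) ≤ e i j

/-- `(M, π)` is a colored multicomplex of type `a`. -/
def IsColoredType {n : ℕ} (a : Fin n → ℕ) (M : Set (MCMon n)) : Prop :=
  ∀ m ∈ M, ∀ i, degOn i m ≤ a i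

/-- `m` and `p` have the same restriction to the variables of colors other than `t`. -/
def agreeAway {n : ℕ} (t : Fin n) (m p : MCMon n) : Prop :=
  ∀ v : Fin n × ℕ, v.1 ≠ t → m v = p v

/-- `𝓜^d_{X_t}(e_t)`: the monomials of degree `d` in the variables of color `t`,
within the bounds `e`. -/
def ColorMon {n : ℕ} (S : Fin n → Set ℕ) (e : Fin n → ℕ → ℕ∞) (t : Fin n) (d : ℕ) :
    Set (MCMon n) :=
  {q | (∀ v ∈ q.support, v.1 = t) ∧ InBounds S e q ∧ totalDeg q = d}

/-- The color-`t` part of `q` is lexicographically at most the color-`t` part of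
`p`: either they are equal, or `q` is strictly smaller at the largest position
where they differ. -/
def lexLePart {n : ℕ} (t : Fin n) (q p : MCMon n) : Prop :=
  (∀ j : ℕ, q (t, j) = p (t, j)) ∨
    ∃ j : ℕ, q (t, j) < p (t, j) ∧ ∀ k : ℕ, j < k → q (t, k) = p (t, k)

/-- The color-`t` part of `p` is a legitimate monomial in the variables of color
`t`, within bounds. -/
def colorPartOk {n : ℕ} (S : Fin n → Set ℕ) (e : Fin n → ℕ → ℕ∞) (t : Fin n)
    (p : MCMon n) : Prop :=
  ∀ j : ℕ, p (t, j) ≠ 0 → j ∈ S t ∧ (p (t, j) : ℕ∞) ≤ e t j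

/-- The color compression operation `C_t`: `p ∈ C_t(M)` iff the restriction of `p`
away from color `t` is the restriction `m̃` of some member of `M`, and the color-`t`
part of `p` lies in the lexicographic initial segment `I^{d;e_t}_{X_t}(f_d(m̃))` of
`𝓜^d_{X_t}(e_t)` (where `d = degOn t p`); membership in this initial segment is
expressed by saying that the number of monomials of `𝓜^d_{X_t}(e_t)` which are
lexicographically at most the color-`t` part of `p` is at most
`f_d(m̃) = #{m ∈ M : m agrees with p away from t, degOn t m = d}`. -/
noncomputable def compressOp {n : ℕ} (S : Fin n → Set ℕ) (e : Fin n → ℕ → ℕ∞)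
    (M : Set (MCMon n)) (t : Fin n) : Set (MCMon n) :=
  {p | (∃ m ∈ M, agreeAway t m p) ∧ colorPartOk S e t p ∧
    {q | q ∈ ColorMon S e t (degOn t p) ∧ lexLePart t q p}.ncard ≤
      {m | m ∈ M ∧ agreeAway t m p ∧ degOn t m = degOn t p}.ncard}

/-- `(M, π)` is color-compressed: for each color `t`, each away-restriction and each
degree, the corresponding set of color-`t` parts is a lex initial segment of
`𝓜^k_{X_t}(e_t)`. -/
def IsColorCompressedM {n : ℕ} (S : Fin n → Set ℕ) (e : Fin n → ℕ → ℕ∞)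
    (M : Set (MCMon n)) : Prop :=
  ∀ t : Fin n, ∀ m ∈ M, ∀ q ∈ ColorMon S e t (degOn t m), lexLePart t q m →
    ∀ p : MCMon n, agreeAway t p m → (∀ j : ℕ, p (t, j) = q (t, j)) → p ∈ M

/-- `f` is the fine f-vector of the colored multicomplex `(M, π)` of type `a`. -/
noncomputable def HasFineFVectorM {n : ℕ} (a : Fin n → ℕ) (M : Set (MCMon n))
    (f : (Fin n → ℕ) → ℤ) : Prop :=
  ∀ b : Fin n → ℕ, (∀ i, b i ≤ a i) →
    f b = ({m | m ∈ M ∧ ∀ i, degOn i m = b i}.ncard : ℤ)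

section InitialSegments

variable {α : Type*} {W : α → ℕ} {F A I : Finset α} {k l : ℕ}

/-- The `k` elements of `F` of smallest weight (when `W` is injective on `F`). -/
def initSeg (W : α → ℕ) (F : Finset α) (k : ℕ) : Finset α :=
  F.filter fun p => #(F.filter fun q => W q ≤ W p) ≤ k

/-- `I` is an initial segment of `F` with respect to the weight `W`. -/
def IsInitSeg (W : α → ℕ) (F I : Finset α) : Prop :=
  I ⊆ F ∧ ∀ p ∈ I, ∀ q ∈ F, W q < W p → q ∈ I

lemma mem_initSeg {p : α} :
    p ∈ initSeg W F k ↔ p ∈ F ∧ #(F.filter fun q => W q ≤ W p) ≤ k := by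
  simp [initSeg]

lemma initSeg_subset : initSeg W F k ⊆ F := filter_subset _ _

lemma initSeg_mono (h : k ≤ l) : initSeg W F k ⊆ initSeg W F l := fun p hp => by
  rw [mem_initSeg] at hp ⊢
  exact ⟨hp.1, hp.2.trans h⟩

lemma mem_initSeg_of_le {p q : α} (hp : p ∈ initSeg W F k) (hq : q ∈ F) (h : W q ≤ W p) :
    q ∈ initSeg W F k := by
  rw [mem_initSeg] at hp ⊢
  refine ⟨hq, (card_le_card fun r hr => ?_).trans hp.2⟩
  rw [mem_filter] at hr ⊢
  exact ⟨hr.1, hr.2.trans h⟩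

lemma isInitSeg_initSeg : IsInitSeg W F (initSeg W F k) :=
  ⟨initSeg_subset, fun _ hp _ hq h => mem_initSeg_of_le hp hq h.le⟩

lemma card_initSeg_le : #(initSeg W F k) ≤ k := by
  rcases (initSeg W F k).eq_empty_or_nonempty with h | h
  · simp [h]
  obtain ⟨p, hp, hmax⟩ := exists_max_image _ W h
  refine (card_le_card fun q hq => ?_).trans (mem_initSeg.1 hp).2
  exact mem_filter.2 ⟨initSeg_subset hq, hmax q hq⟩

lemma card_initSeg (hW : Set.InjOn W F) (hk : k ≤ #F) : #(initSeg W F k) = k := by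
  classical
  refine card_initSeg_le.antisymm (not_lt.1 fun hlt => ?_)
  have hne : (F \ initSeg W F k).Nonempty := by
    rw [← card_pos, card_sdiff_of_subset initSeg_subset]
    omega
  obtain ⟨p, hp, hmin⟩ := exists_min_image _ W hne
  rw [mem_sdiff] at hp
  refine hp.2 (mem_initSeg.2 ⟨hp.1, (card_le_card (t := insert p (initSeg W F k))
    fun q hq => ?_).trans ((card_insert_le _ _).trans hlt)⟩)
  rw [mem_filter] at hq
  rw [mem_insert]
  by_contra! hcon
  have := hmin q (mem_sdiff.2 ⟨hq.1, hcon.2⟩)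
  exact hcon.1 (hW hq.1 hp.1 (hq.2.antisymm this))

lemma IsInitSeg.eq_initSeg (hW : Set.InjOn W F) (hI : IsInitSeg W F I) :
    I = initSeg W F #I := by
  refine eq_of_subset_of_card_le (fun p hp => ?_) card_initSeg_le
  refine mem_initSeg.2 ⟨hI.1 hp, card_le_card fun q hq => ?_⟩
  rw [mem_filter] at hq
  rcases hq.2.lt_or_eq with h | h
  · exact hI.2 p hp q hq.1 h
  · exact hW hq.1 (hI.1 hp) h ▸ hp

lemma sum_initSeg_lt (hW : Set.InjOn W F) (hA : A ⊆ F) (hne : A ≠ initSeg W F #A) :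
    ∑ p ∈ initSeg W F #A, W p < ∑ p ∈ A, W p := by
  classical
  set J := initSeg W F #A with hJ
  have hc : #J = #A := card_initSeg hW (card_le_card hA)
  have hsd : #(J \ A) = #(A \ J) := by
    have h1 := card_sdiff_add_card_inter J A
    have h2 := card_sdiff_add_card_inter A J
    rw [inter_comm] at h2
    omega
  have hpos : (J \ A).Nonempty := by
    rw [← card_pos, hsd, card_pos, nonempty_iff_ne_empty, Ne, sdiff_eq_empty_iff_subset]
    exact fun h => hne (eq_of_subset_of_card_le h hc.le)
  obtain ⟨p, hp, hmax⟩ := exists_max_image _ W hpos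
  rw [mem_sdiff] at hp
  have hlow : ∀ q ∈ A \ J, W p + 1 ≤ W q := fun q hq => by
    rw [mem_sdiff] at hq
    exact not_le.1 fun h => hq.2 (mem_initSeg_of_le hp.1 (hA hq.1) h)
  have h1 : ∑ q ∈ J \ A, W q ≤ #(J \ A) * W p := by
    simpa using sum_le_card_nsmul _ _ _ hmax
  have h2 : #(A \ J) * (W p + 1) ≤ ∑ q ∈ A \ J, W q := by
    simpa using card_nsmul_le_sum _ _ _ hlow
  have h3 := sum_inter_add_sum_sdiff J A W
  have h4 := sum_inter_add_sum_sdiff A J W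
  rw [inter_comm] at h4
  have h5 := hpos.card_pos
  rw [← hsd] at h2
  nlinarith

end InitialSegments

section Monomials

variable {V : Type*} {u p q : V →₀ ℕ} {pos : V → ℕ} {B : ℕ} {T : Finset V}

/-- The base-`B` weight of a monomial, the variable `v` contributing the digit position `pos v`. -/
def wt (B : ℕ) (pos : V → ℕ) (m : V →₀ ℕ) : ℕ := m.sum fun v k => k * B ^ pos v

lemma wt_add_single (m : V →₀ ℕ) (v : V) :
    wt B pos (m + Finsupp.single v 1) = wt B pos m + B ^ pos v := by
  classical
  unfold wt
  rw [Finsupp.sum_add_index' (by simp) (by intros; ring), Finsupp.sum_single_index (by simp)]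
  simp

lemma sum_mul_pow_lt {L : Finset V} (hpos : Set.InjOn pos L) (hB0 : 0 < B) (hB : ∀ v, q v < B)
    {k : ℕ} (hk : ∀ v ∈ L, pos v < k) : ∑ v ∈ L, q v * B ^ pos v < B ^ k := by
  calc ∑ v ∈ L, q v * B ^ pos v ≤ ∑ v ∈ L, (B - 1) * B ^ pos v :=
        sum_le_sum fun v _ => Nat.mul_le_mul_right _ (Nat.le_sub_one_of_lt (hB v))
    _ = (B - 1) * ∑ i ∈ L.image pos, B ^ i := by
        rw [← mul_sum, sum_image hpos]
    _ ≤ (B - 1) * ∑ i ∈ range k, B ^ i :=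
        Nat.mul_le_mul_left _ (sum_le_sum_of_subset fun i hi => by
          obtain ⟨v, hv, rfl⟩ := mem_image.1 hi
          exact mem_range.2 (hk v hv))
    _ = B ^ k - 1 := by rw [mul_comm]; exact geom_sum_mul_of_one_le hB0 k
    _ < B ^ k := Nat.sub_lt (Nat.pow_pos hB0) one_pos

lemma wt_lt_of_lex (hpos : Set.InjOn pos T) (hB : ∀ v, q v < B)
    (hoff : ∀ v ∉ T, q v = p v) {v : V} (hv : v ∈ T) (hlt : q v < p v)
    (hup : ∀ w ∈ T, pos v < pos w → q w = p w) : wt B pos q < wt B pos p := by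
  classical
  have hexp : ∀ m : V →₀ ℕ, m = p ∨ m = q → wt B pos m =
      (∑ w ∈ (p.support ∪ q.support) \ T, m w * B ^ pos w) + ∑ w ∈ T, m w * B ^ pos w := by
    intro m hm
    unfold wt
    rw [Finsupp.sum_of_support_subset (s := p.support ∪ q.support ∪ T) m _ _ (by simp),
      ← sdiff_union_self_eq_union, sum_union sdiff_disjoint]
    rcases hm with rfl | rfl
    · exact fun w hw => by simp only [mem_union]; tauto
    · exact fun w hw => by simp only [mem_union]; tauto
  rw [hexp p (.inl rfl), hexp q (.inr rfl)]
  have h1 : ∑ w ∈ (p.support ∪ q.support) \ T, q w * B ^ pos w =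
      ∑ w ∈ (p.support ∪ q.support) \ T, p w * B ^ pos w :=
    sum_congr rfl fun w hw => by rw [hoff w (mem_sdiff.1 hw).2]
  rw [h1]
  refine Nat.add_lt_add_left ?_ _
  have hsplit : ∀ m : V →₀ ℕ, ∑ w ∈ T, m w * B ^ pos w =
      m v * B ^ pos v + (∑ w ∈ T with pos w < pos v, m w * B ^ pos w) +
        ∑ w ∈ T with pos v < pos w, m w * B ^ pos w := by
    intro m
    rw [← add_sum_erase T _ hv, add_assoc,
      ← sum_filter_add_sum_filter_not (T.erase v) (fun w => pos w < pos v)]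
    congr 2
    · refine sum_congr (ext fun w => ?_) fun _ _ => rfl
      simp only [mem_filter, mem_erase]
      exact ⟨fun h => ⟨h.1.2, h.2⟩, fun h => ⟨⟨fun e => by simp [e] at h, h.1⟩, h.2⟩⟩
    · refine sum_congr (ext fun w => ?_) fun _ _ => rfl
      simp only [mem_filter, mem_erase, not_lt]
      exact ⟨fun h => ⟨h.1.2, h.2.lt_of_ne fun e => h.1.1 (hpos h.1.2 hv e.symm)⟩,
        fun h => ⟨⟨fun e => by simp [e] at h, h.1⟩, h.2.le⟩⟩
  rw [hsplit, hsplit]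
  have h2 : ∑ w ∈ T with pos v < pos w, q w * B ^ pos w =
      ∑ w ∈ T with pos v < pos w, p w * B ^ pos w :=
    sum_congr rfl fun w hw => by rw [hup w (mem_filter.1 hw).1 (mem_filter.1 hw).2]
  have h3 : ∑ w ∈ T with pos w < pos v, q w * B ^ pos w < B ^ pos v :=
    sum_mul_pow_lt (hpos.mono (filter_subset _ _)) ((Nat.zero_le _).trans_lt (hB v)) hB
      fun w hw => (mem_filter.1 hw).2
  have h4 : (q v + 1) * B ^ pos v ≤ p v * B ^ pos v := Nat.mul_le_mul_right _ hlt
  rw [h2]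
  have h5 := Nat.zero_le (∑ w ∈ T with pos w < pos v, p w * B ^ pos w)
  linarith

/-- Two distinct monomials agreeing off `T` differ in a variable of `T` of highest position. -/
lemma exists_top_ne (hoff : ∀ v ∉ T, q v = p v) (hne : q ≠ p) :
    ∃ v ∈ T, q v ≠ p v ∧ ∀ w ∈ T, pos v < pos w → q w = p w := by
  classical
  obtain ⟨v₀, hv₀⟩ := DFunLike.ne_iff.1 hne
  have hne' : (T.filter fun v => q v ≠ p v).Nonempty :=
    ⟨v₀, mem_filter.2 ⟨by_contra fun h => hv₀ (hoff _ h), hv₀⟩⟩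
  obtain ⟨v, hv, hmax⟩ := exists_max_image _ pos hne'
  rw [mem_filter] at hv
  refine ⟨v, hv.1, hv.2, fun w hw hlt => ?_⟩
  by_contra h
  exact absurd (hmax w (mem_filter.2 ⟨hw, h⟩)) (not_le.2 hlt)

lemma exists_lex_of_wt_lt (hpos : Set.InjOn pos T) (hB : ∀ v, p v < B)
    (hoff : ∀ v ∉ T, q v = p v) (hlt : wt B pos q < wt B pos p) :
    ∃ v ∈ T, q v < p v ∧ ∀ w ∈ T, pos v < pos w → q w = p w := by
  obtain ⟨v, hv, hne, hup⟩ := exists_top_ne (pos := pos) hoff (by rintro rfl; exact hlt.false)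
  refine ⟨v, hv, hne.lt_of_le (not_lt.1 fun h => ?_), hup⟩
  exact hlt.not_gt (wt_lt_of_lex hpos hB (fun w hw => (hoff w hw).symm) hv h
    fun w hw h' => (hup w hw h').symm)

lemma wt_le_of_le_off_min (hpos : Set.InjOn pos T) (hB : ∀ v, q v < B)
    (hoff : ∀ v ∉ T, q v = p v) (hsum : ∑ v ∈ T, q v = ∑ v ∈ T, p v) {b : V} (hb : b ∈ T)
    (hmin : ∀ v ∈ T, v ≠ b → pos b < pos v) (hle : ∀ v ∈ T, v ≠ b → q v ≤ p v) :
    wt B pos q ≤ wt B pos p := by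
  classical
  refine not_lt.1 fun hlt => ?_
  obtain ⟨v, hv, hv', hup⟩ := exists_lex_of_wt_lt hpos hB (fun w hw => (hoff w hw).symm) hlt
  by_cases hvb : v = b
  · subst hvb
    rw [← add_sum_erase T _ hv, ← add_sum_erase T (fun v => p v) hv] at hsum
    have : ∑ w ∈ T.erase v, q w = ∑ w ∈ T.erase v, p w := sum_congr rfl fun w hw =>
      (hup w (mem_of_mem_erase hw) (hmin w (mem_of_mem_erase hw) (ne_of_mem_erase hw))).symm
    omega
  · exact absurd (hle v hv hvb) (not_le.2 hv')

lemma exists_between_sum_eq {f g : V →₀ ℕ} (hfg : f ≤ g) {s : ℕ} (h1 : ∑ v ∈ T, f v ≤ s)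
    (h2 : s ≤ ∑ v ∈ T, g v) : ∃ h : V →₀ ℕ, f ≤ h ∧ h ≤ g ∧ ∑ v ∈ T, h v = s := by
  classical
  induction s, h1 using Nat.le_induction with
  | base => exact ⟨f, le_rfl, hfg, rfl⟩
  | succ s hs ih =>
    obtain ⟨h, hf, hg, hh⟩ := ih (by omega)
    obtain ⟨v, hv, hlt⟩ := exists_lt_of_sum_lt (s := T) (f := h) (g := g) (by omega)
    refine ⟨h + Finsupp.single v 1, hf.trans (by simp), fun w => ?_, ?_⟩
    · by_cases hw : v = w
      · subst hw; simpa using hlt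
      · simpa [Finsupp.single_apply, hw] using hg w
    · simp [sum_add_distrib, Finsupp.single_apply, hh, hv]

/-- A set of monomials closed under division by a variable is closed under divisibility. -/
lemma isLowerSet_of_add_single
    {M : Finset (V →₀ ℕ)} (h : ∀ p v, p + Finsupp.single v 1 ∈ M → p ∈ M) :
    IsLowerSet (M : Set (V →₀ ℕ)) := by
  have key : ∀ r p : V →₀ ℕ, p + r ∈ M → p ∈ M := by
    intro r
    induction r using Finsupp.induction_linear with
    | zero => simp
    | add f g hf hg =>
      intro p hp
      rw [← add_assoc] at hp
      exact hf _ (hg _ hp)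
    | single v k =>
      induction k with
      | zero => simp
      | succ k ih =>
        intro p hp
        rw [Finsupp.single_add, ← add_assoc] at hp
        exact ih _ (h _ _ hp)
  intro a b hab ha
  refine key (a - b) b ?_
  rwa [add_tsub_cancel_of_le hab]

end Monomials

section Compression

variable {V : Type*} [DecidableEq V] {u p q : V →₀ ℕ} {T : Finset V} {W : (V →₀ ℕ) → ℕ}
  {M A I : Finset (V →₀ ℕ)} {s : ℕ}

open Classical in
/-- The monomials dividing `u` which agree with `p` off `T` and have degree `s` on `T`. -/
noncomputable def level (u : V →₀ ℕ) (T : Finset V) (p : V →₀ ℕ) (s : ℕ) : Finset (V →₀ ℕ) :=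
  (Iic u).filter fun q => (∀ v ∉ T, q v = p v) ∧ ∑ v ∈ T, q v = s

/-- The level containing `p`. -/
noncomputable def fiber (u : V →₀ ℕ) (T : Finset V) (p : V →₀ ℕ) : Finset (V →₀ ℕ) :=
  level u T p (∑ v ∈ T, p v)

/-- Replace the part of `M` in each fiber by the initial segment of the same size. -/
noncomputable def compress (u : V →₀ ℕ) (W : (V →₀ ℕ) → ℕ) (T : Finset V)
    (M : Finset (V →₀ ℕ)) : Finset (V →₀ ℕ) :=
  (Iic u).filter fun p => p ∈ initSeg W (fiber u T p) #(M ∩ fiber u T p)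

lemma mem_level :
    q ∈ level u T p s ↔ q ≤ u ∧ (∀ v ∉ T, q v = p v) ∧ ∑ v ∈ T, q v = s := by
  simp [level]

lemma mem_fiber :
    q ∈ fiber u T p ↔ q ≤ u ∧ (∀ v ∉ T, q v = p v) ∧ ∑ v ∈ T, q v = ∑ v ∈ T, p v :=
  mem_level

lemma self_mem_fiber (hp : p ≤ u) : p ∈ fiber u T p := mem_fiber.2 ⟨hp, fun _ _ => rfl, rfl⟩

lemma level_congr (h : ∀ v ∉ T, q v = p v) : level u T q s = level u T p s := by
  ext r
  simp only [mem_level]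
  refine and_congr_right fun _ => and_congr_left fun _ => forall₂_congr fun v hv => ?_
  rw [h v hv]

lemma fiber_eq_level (hq : q ∈ level u T p s) : fiber u T q = level u T p s := by
  rw [mem_level] at hq
  rw [fiber, level_congr hq.2.1, hq.2.2]

lemma fiber_eq_of_mem (hq : q ∈ fiber u T p) : fiber u T q = fiber u T p := fiber_eq_level hq

lemma compress_subset : compress u W T M ⊆ Iic u := filter_subset _ _

lemma mem_compress :
    p ∈ compress u W T M ↔ p ≤ u ∧ p ∈ initSeg W (fiber u T p) #(M ∩ fiber u T p) := by
  simp [compress]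

lemma compress_inter_fiber :
    compress u W T M ∩ fiber u T p = initSeg W (fiber u T p) #(M ∩ fiber u T p) := by
  ext q
  rw [mem_inter, mem_compress]
  constructor
  · rintro ⟨⟨-, h⟩, hq⟩
    rwa [fiber_eq_of_mem hq] at h
  · intro h
    have hq := initSeg_subset h
    exact ⟨⟨(mem_fiber.1 hq).1, by rwa [fiber_eq_of_mem hq]⟩, hq⟩

lemma compress_filter {P : (V →₀ ℕ) → Prop} [DecidablePred P]
    (hP : ∀ p, p ≤ u → ∀ q ∈ fiber u T p, (P q ↔ P p)) :
    compress u W T (M.filter P) = (compress u W T M).filter P := by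
  ext p
  rw [mem_filter, mem_compress, mem_compress, and_assoc]
  refine and_congr_right fun hpu => ?_
  by_cases hp : P p
  · have : M.filter P ∩ fiber u T p = M ∩ fiber u T p := by
      ext q
      simp only [mem_inter, mem_filter]
      exact ⟨fun h => ⟨h.1.1, h.2⟩, fun h => ⟨⟨h.1, (hP p hpu q h.2).2 hp⟩, h.2⟩⟩
    rw [this]
    tauto
  · have : M.filter P ∩ fiber u T p = ∅ := by
      refine eq_empty_of_forall_notMem fun q hq => ?_
      simp only [mem_inter, mem_filter] at hq
      exact hp ((hP p hpu q hq.2).1 hq.1.2)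
    have h0 : initSeg W (fiber u T p) 0 = ∅ := card_eq_zero.1 (Nat.le_zero.1 card_initSeg_le)
    simp [this, h0, hp]

lemma sum_eq_sum_inter_fiber (hM : M ⊆ Iic u) (g : (V →₀ ℕ) → ℕ) :
    ∑ p ∈ M, g p = ∑ Φ ∈ (Iic u).image (fiber u T), ∑ p ∈ M ∩ Φ, g p := by
  rw [← sum_fiberwise_of_maps_to (g := fiber u T) fun p hp => mem_image_of_mem _ (hM hp)]
  refine sum_congr rfl fun Φ hΦ => sum_congr ?_ fun _ _ => rfl
  obtain ⟨p, hp, rfl⟩ := mem_image.1 hΦ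
  ext q
  rw [mem_filter, mem_inter]
  refine and_congr_right fun hq => ⟨fun h => ?_, fiber_eq_of_mem⟩
  exact h ▸ self_mem_fiber (mem_Iic.1 (hM hq))

lemma card_compress (hW : ∀ p, Set.InjOn W (fiber u T p)) (hM : M ⊆ Iic u) :
    #(compress u W T M) = #M := by
  rw [card_eq_sum_ones, card_eq_sum_ones, sum_eq_sum_inter_fiber (T := T) hM,
    sum_eq_sum_inter_fiber (T := T) compress_subset]
  refine sum_congr rfl fun Φ hΦ => ?_
  obtain ⟨p, hp, rfl⟩ := mem_image.1 hΦ
  rw [compress_inter_fiber, ← card_eq_sum_ones, ← card_eq_sum_ones,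
    card_initSeg (hW p) (card_le_card inter_subset_right)]

lemma sum_compress_lt (hW : ∀ p, Set.InjOn W (fiber u T p)) (hM : M ⊆ Iic u)
    (hne : compress u W T M ≠ M) : ∑ p ∈ compress u W T M, W p < ∑ p ∈ M, W p := by
  have key : ∀ p, M ∩ fiber u T p ≠ compress u W T M ∩ fiber u T p →
      ∑ q ∈ compress u W T M ∩ fiber u T p, W q < ∑ q ∈ M ∩ fiber u T p, W q := by
    intro p h
    rw [compress_inter_fiber] at h ⊢
    exact sum_initSeg_lt (hW p) inter_subset_right h
  rw [sum_eq_sum_inter_fiber (T := T) hM, sum_eq_sum_inter_fiber (T := T) compress_subset]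
  refine sum_lt_sum (fun Φ hΦ => ?_) ?_
  · obtain ⟨p, hp, rfl⟩ := mem_image.1 hΦ
    by_cases h : M ∩ fiber u T p = compress u W T M ∩ fiber u T p
    · rw [h]
    · exact (key p h).le
  · by_contra! hcon
    refine hne (ext fun p => ?_)
    by_cases hp : p ≤ u
    · have h : M ∩ fiber u T p = compress u W T M ∩ fiber u T p := by
        by_contra h
        exact (hcon _ (mem_image_of_mem _ (mem_Iic.2 hp))).not_gt (key p h)
      have := congrArg (p ∈ ·) h
      simpa [self_mem_fiber hp] using this.symm
    · exact iff_of_false (fun h => hp (mem_Iic.1 (compress_subset h)))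
        fun h => hp (mem_Iic.1 (hM h))

lemma mem_of_compress_eq (hM : compress u W T M = M) (hp : p ∈ M) (hq : q ∈ fiber u T p)
    (h : W q ≤ W p) : q ∈ M := by
  rw [← hM, mem_compress] at hp ⊢
  refine ⟨(mem_fiber.1 hq).1, ?_⟩
  rw [fiber_eq_of_mem hq]
  exact mem_initSeg_of_le hp.2 hq h

lemma injOn_wt_fiber {pos : V → ℕ} {B : ℕ} (hpos : Set.InjOn pos T) (hB : ∀ v, u v < B)
    (p : V →₀ ℕ) : Set.InjOn (wt B pos) (fiber u T p) := by
  intro q hq r hr h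
  rw [mem_coe, mem_fiber] at hq hr
  by_contra hne
  have hoff : ∀ v ∉ T, q v = r v := fun v hv => (hq.2.1 v hv).trans (hr.2.1 v hv).symm
  obtain ⟨v, hv, hv', hup⟩ := exists_top_ne (pos := pos) hoff hne
  rcases hv'.lt_or_gt with hlt | hlt
  · exact (wt_lt_of_lex hpos (fun w => (hq.1 w).trans_lt (hB w)) hoff hv hlt hup).ne h
  · exact (wt_lt_of_lex hpos (fun w => (hr.1 w).trans_lt (hB w)) (fun w hw => (hoff w hw).symm)
      hv hlt fun w hw h => (hup w hw h).symm).ne h.symm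

/-- The monomials obtained from members of `A` by dividing by one variable of `T`. -/
noncomputable def lowerShadow (T : Finset V) (A : Finset (V →₀ ℕ)) : Finset (V →₀ ℕ) :=
  A.biUnion fun a => (T.filter fun v => a v ≠ 0).image fun v => a - Finsupp.single v 1

lemma mem_lowerShadow : p ∈ lowerShadow T A ↔ ∃ v ∈ T, p + Finsupp.single v 1 ∈ A := by
  simp only [lowerShadow, mem_biUnion, mem_image, mem_filter]
  constructor
  · rintro ⟨a, ha, v, ⟨hv, hav⟩, rfl⟩
    refine ⟨v, hv, ?_⟩
    rwa [tsub_add_cancel_of_le]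
    simpa using Nat.one_le_iff_ne_zero.2 hav
  · rintro ⟨v, hv, h⟩
    exact ⟨_, h, v, ⟨hv, by simp⟩, by simp⟩

lemma mem_level_of_add_single {v : V} (hv : v ∈ T)
    (h : p + Finsupp.single v 1 ∈ level u T q (s + 1)) : p ∈ level u T q s := by
  rw [mem_level] at h ⊢
  refine ⟨le_self_add.trans h.1, fun w hw => ?_, ?_⟩
  · rw [← h.2.1 w hw]
    simp [show v ≠ w by rintro rfl; exact hw hv]
  · simpa [sum_add_distrib, Finsupp.single_apply, hv] using h.2.2

lemma add_single_mem_level {v : V} (hv : v ∈ T) (h : p ∈ level u T q s) (hlt : p v < u v) :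
    p + Finsupp.single v 1 ∈ level u T q (s + 1) := by
  rw [mem_level] at h ⊢
  refine ⟨fun w => ?_, fun w hw => ?_, ?_⟩
  · by_cases hw : v = w
    · subst hw; simpa using hlt
    · simpa [Finsupp.single_apply, hw] using h.1 w
  · rw [← h.2.1 w hw]
    simp [show v ≠ w by rintro rfl; exact hw hv]
  · simp [sum_add_distrib, Finsupp.single_apply, hv, h.2.2]

lemma lowerShadow_subset_level (hA : A ⊆ level u T p (s + 1)) :
    lowerShadow T A ⊆ level u T p s := fun q hq => by
  obtain ⟨v, hv, h⟩ := mem_lowerShadow.1 hq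
  exact mem_level_of_add_single hv (hA h)

/-- On the block `T`, every set of monomials of fixed degree has at least as large a lower shadow
as some initial segment of the same size. -/
def InitSegMinimizesShadow (u : V →₀ ℕ) (W : (V →₀ ℕ) → ℕ) (T : Finset V) : Prop :=
  ∀ (p : V →₀ ℕ) (s : ℕ), ∀ A ⊆ level u T p (s + 1), ∃ I, IsInitSeg W (level u T p (s + 1)) I ∧
    #I = #A ∧ #(lowerShadow T I) ≤ #(lowerShadow T A)

variable {pos : V → ℕ} {B : ℕ}

lemma isInitSeg_lowerShadow (hpos : Set.InjOn pos T) (hB : ∀ v, u v < B)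
    (hI : IsInitSeg (wt B pos) (level u T p (s + 1)) I) :
    IsInitSeg (wt B pos) (level u T p s) (lowerShadow T I) := by
  refine ⟨lowerShadow_subset_level hI.1, fun z hz z' hz' hlt => ?_⟩
  obtain ⟨i, hi, hzi⟩ := mem_lowerShadow.1 hz
  have hzl := mem_level.1 (lowerShadow_subset_level hI.1 hz)
  have hzl' := mem_level.1 hz'
  have hzil := mem_level.1 (hI.1 hzi)
  have hoff : ∀ v ∉ T, z' v = z v := fun v hv => (hzl'.2.1 v hv).trans (hzl.2.1 v hv).symm
  obtain ⟨m, hm, hmlt, hmup⟩ :=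
    exists_lex_of_wt_lt hpos (fun v => (hzl.1 v).trans_lt (hB v)) hoff hlt
  obtain ⟨j, hj, hjmin⟩ := exists_min_image (T.filter fun v => z' v < u v) pos
    ⟨m, mem_filter.2 ⟨hm, hmlt.trans_le (hzl.1 m)⟩⟩
  rw [mem_filter] at hj
  have hw := add_single_mem_level hj.1 hz' hj.2
  have hwl := mem_level.1 hw
  refine mem_lowerShadow.2 ⟨j, hj.1, ?_⟩
  have hBpos : 0 < B := (Nat.zero_le _).trans_lt (hB j)
  rcases le_or_gt (pos j) (pos i) with hji | hij
  · refine hI.2 _ hzi _ hw ?_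
    rw [wt_add_single, wt_add_single]
    exact add_lt_add_of_lt_of_le hlt (Nat.pow_le_pow_right hBpos hji)
  rcases lt_trichotomy (wt B pos (z' + Finsupp.single j 1)) (wt B pos (z + Finsupp.single i 1))
    with h | h | h
  · exact hI.2 _ hzi _ hw h
  · have := injOn_wt_fiber hpos hB _ (by rw [fiber_eq_level hw]; exact hw)
      (by rw [fiber_eq_level hw]; exact hI.1 hzi) h
    rwa [this]
  exfalso
  have hoff' : ∀ v ∉ T, (z + Finsupp.single i 1 : V →₀ ℕ) v =
      (z' + Finsupp.single j 1 : V →₀ ℕ) v :=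
    fun v hv => (hzil.2.1 v hv).trans (hwl.2.1 v hv).symm
  obtain ⟨v, hv, hvlt, hvup⟩ :=
    exists_lex_of_wt_lt hpos (fun v => (hwl.1 v).trans_lt (hB v)) hoff' h
  have hjm : pos j ≤ pos m := hjmin m (mem_filter.2 ⟨hm, hmlt.trans_le (hzl.1 m)⟩)
  have hij' : i ≠ j := by rintro rfl; exact hij.false
  have him : i ≠ m := by rintro rfl; omega
  have hzm : (z' + Finsupp.single j 1 : V →₀ ℕ) m ≤ (z + Finsupp.single i 1 : V →₀ ℕ) m := by
    simp only [Finsupp.add_apply, Finsupp.single_apply]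
    split_ifs <;> omega
  have hvm : pos v < pos m := by
    by_contra! hmv
    rcases hmv.lt_or_eq with hmv | hmv
    · have hjv : j ≠ v := by rintro rfl; omega
      simp [Finsupp.single_apply, hjv, hmup v hv hmv] at hvlt
    · rw [← hpos hm hv hmv] at hvlt
      omega
  have hjm' : j = m := by
    by_contra hjm'
    have := hvup m hm hvm
    simp [hjm', him] at this
    omega
  subst hjm'
  have hsum : ∑ w ∈ T, (z + Finsupp.single i 1 : V →₀ ℕ) w <
      ∑ w ∈ T, (z' + Finsupp.single j 1 : V →₀ ℕ) w := by
    refine sum_lt_sum (fun w hw' => ?_) ⟨v, hv, hvlt⟩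
    rcases lt_or_ge (pos v) (pos w) with h1 | h1
    · exact (hvup w hw' h1).le
    · have h2 : u w ≤ z' w := not_lt.1 fun hlt' =>
        absurd (hjmin w (mem_filter.2 ⟨hw', hlt'⟩)) (by omega)
      exact (hzil.1 w).trans (h2.trans (by simp))
  rw [hzil.2.2, hwl.2.2] at hsum
  exact hsum.false

/-- If initial segments minimize shadows on the block `T`, then compressing the block `T`
preserves multicomplexes. -/
lemma InitSegMinimizesShadow.isLowerSet_compress (hpos : Set.InjOn pos T) (hB : ∀ v, u v < B)
    (hT : InitSegMinimizesShadow u (wt B pos) T) (hM : IsLowerSet (M : Set (V →₀ ℕ))) :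
    IsLowerSet (compress u (wt B pos) T M : Set (V →₀ ℕ)) := by
  refine isLowerSet_of_add_single fun p v hp => ?_
  have hpu := (mem_compress.1 hp).1
  have hpu' : p ≤ u := le_self_add.trans hpu
  by_cases hv : v ∈ T
  · have hF : fiber u T (p + Finsupp.single v 1) = level u T p (∑ w ∈ T, p w + 1) := by
      refine fiber_eq_level (add_single_mem_level hv (self_mem_fiber hpu') ?_)
      simpa using hpu v
    have hinj := injOn_wt_fiber hpos hB (p + Finsupp.single v 1)
    obtain ⟨I, hI, hIcard, hsh⟩ := hT p (∑ w ∈ T, p w)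
      (M ∩ level u T p (∑ w ∈ T, p w + 1)) inter_subset_right
    have hpI := (mem_compress.1 hp).2
    rw [hF] at hpI hinj
    rw [← hIcard, ← hI.eq_initSeg hinj] at hpI
    have hshI := (isInitSeg_lowerShadow hpos hB hI).eq_initSeg (injOn_wt_fiber hpos hB p)
    refine mem_compress.2 ⟨hpu', initSeg_mono (hsh.trans (card_le_card fun q hq => ?_))
      (hshI ▸ mem_lowerShadow.2 ⟨v, hv, hpI⟩)⟩
    have hqG := lowerShadow_subset_level inter_subset_right hq
    obtain ⟨w, hw, hqw⟩ := mem_lowerShadow.1 hq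
    exact mem_inter.2 ⟨hM (le_self_add : q ≤ _) (mem_inter.1 hqw).1, hqG⟩
  · have hsum : ∀ q : V →₀ ℕ, ∑ w ∈ T, (q + Finsupp.single v 1 : V →₀ ℕ) w = ∑ w ∈ T, q w := by
      intro q
      simp [sum_add_distrib, Finsupp.single_apply, hv]
    refine mem_compress.2 ⟨hpu', mem_initSeg.2 ⟨self_mem_fiber hpu', ?_⟩⟩
    have hp2 := (mem_initSeg.1 (mem_compress.1 hp).2).2
    have hstep : ∀ q ∈ fiber u T p, q + Finsupp.single v 1 ∈
        fiber u T (p + Finsupp.single v 1) := by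
      intro q hq
      rw [mem_fiber] at hq ⊢
      refine ⟨fun w => ?_, fun w hw => by simp [hq.2.1 w hw], by rw [hsum, hsum, hq.2.2]⟩
      by_cases hw : w ∈ T
      · have hvw : v ≠ w := by rintro rfl; exact hv hw
        simpa [Finsupp.single_apply, hvw] using hq.1 w
      · have := hpu w
        rw [Finsupp.add_apply] at this ⊢
        rwa [hq.2.1 w hw]
    calc _ ≤ _ := card_le_card_of_injOn (· + Finsupp.single v 1) (fun q hq => ?_)
          (add_left_injective _).injOn
      _ ≤ _ := hp2
      _ ≤ _ := card_le_card_of_injOn (· - Finsupp.single v 1) (fun q hq => ?_) ?_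
    · rw [mem_coe, mem_filter] at hq ⊢
      refine ⟨hstep q hq.1, ?_⟩
      rw [wt_add_single, wt_add_single]
      exact Nat.add_le_add_right hq.2 _
    · rw [mem_coe, mem_inter, mem_fiber] at hq ⊢
      refine ⟨hM (tsub_le_self : q - Finsupp.single v 1 ≤ q) hq.1,
        tsub_le_self.trans hq.2.1, fun w hw => ?_, ?_⟩
      · simp [hq.2.2.1 w hw]
      · rw [← hsum p, ← hq.2.2.2]
        refine sum_congr rfl fun w hw => ?_
        have hvw : v ≠ w := by rintro rfl; exact hv hw
        simp [hvw]
    · have hle : ∀ q ∈ M ∩ fiber u T (p + Finsupp.single v 1), Finsupp.single v 1 ≤ q := by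
        intro q hq
        have := (mem_fiber.1 (mem_inter.1 hq).2).2.1 v hv
        simp [this]
      intro q hq r hr h
      rw [← tsub_add_cancel_of_le (hle q hq), ← tsub_add_cancel_of_le (hle r hr)]
      exact congrArg (· + Finsupp.single v 1) h

end Compression

section ClementsLindstrom

variable {V : Type*} [DecidableEq V] {u p x y : V →₀ ℕ} {T : Finset V} {A : Finset (V →₀ ℕ)}
  {s : ℕ} {pos : V → ℕ} {B : ℕ} {b t : V}

lemma initSegMinimizesShadow_of_card_le_one {W : (V →₀ ℕ) → ℕ} (hT : #T ≤ 1) :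
    InitSegMinimizesShadow u W T := by
  intro p s A hA
  refine ⟨A, ⟨hA, fun x hx y hy _ => ?_⟩, rfl, le_rfl⟩
  suffices y = x from this ▸ hx
  have hx := mem_level.1 (hA hx)
  rw [mem_level] at hy
  ext v
  by_cases hv : v ∈ T
  · obtain rfl : T = {v} := eq_singleton_iff_unique_mem.2
      ⟨hv, fun w hw => card_le_one.1 hT w hw v hv⟩
    simpa using hy.2.2.trans hx.2.2.symm
  · rw [hy.2.1 v hv, hx.2.1 v hv]

lemma eq_of_mem_level_pair (hbt : b ≠ t) (hx : x ∈ level u {b, t} p s)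
    (hy : y ∈ level u {b, t} p s) (h : x b = y b) : x = y := by
  rw [mem_level, sum_pair hbt] at hx hy
  ext v
  by_cases hv : v ∈ ({b, t} : Finset V)
  · rw [mem_insert, mem_singleton] at hv
    rcases hv with rfl | rfl
    · exact h
    · omega
  · rw [hx.2.1 v hv, hy.2.1 v hv]

lemma sub_single_mem_lowerShadow {v : V} (hv : v ∈ T) (hx : x ∈ A) (h : 0 < x v) :
    x - Finsupp.single v 1 ∈ lowerShadow T A := by
  refine mem_lowerShadow.2 ⟨v, hv, ?_⟩
  rwa [tsub_add_cancel_of_le]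
  exact Finsupp.single_le_iff.2 h

lemma card_lt_card_lowerShadow_pair (hbt : b ≠ t) (hA : A ⊆ level u {b, t} p (s + 1))
    (hne : A.Nonempty) (hb : u b ≤ s) (ht : u t ≤ s) : #A < #(lowerShadow {b, t} A) := by
  have hl : ∀ a ∈ A, a b ≤ u b ∧ a t ≤ u t ∧ a b + a t = s + 1 := fun a ha => by
    have := mem_level.1 (hA ha)
    rw [sum_pair hbt] at this
    exact ⟨this.1 b, this.1 t, this.2.2⟩
  obtain ⟨y, hy, hmin⟩ := exists_min_image A (fun a => a b) hne
  have hinj : Set.InjOn (fun a : V →₀ ℕ => a - Finsupp.single t 1) A := by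
    intro a ha a' ha' h
    refine eq_of_mem_level_pair hbt (hA ha) (hA ha') ?_
    simpa [hbt.symm, hbt] using DFunLike.congr_fun h b
  have hnot : y - Finsupp.single b 1 ∉ A.image fun a => a - Finsupp.single t 1 := by
    rw [mem_image]
    rintro ⟨a, ha, h⟩
    have h1 := DFunLike.congr_fun h b
    simp [hbt] at h1
    have := hmin a ha
    have := hl y hy
    omega
  rw [← card_image_of_injOn hinj, Nat.lt_iff_add_one_le, ← card_insert_of_notMem hnot]
  refine card_le_card (insert_subset (sub_single_mem_lowerShadow (by simp) hy ?_)
    (image_subset_iff.2 fun a ha => sub_single_mem_lowerShadow (by simp) ha ?_))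
  · have := hl y hy
    omega
  · have := hl a ha
    omega

lemma card_le_card_lowerShadow_pair (hbt : b ≠ t) (hA : A ⊆ level u {b, t} p (s + 1))
    (hne : A ≠ level u {b, t} p (s + 1)) : #A ≤ #(lowerShadow {b, t} A) := by
  obtain ⟨z, hz, hzA⟩ := exists_of_ssubset (hA.ssubset_of_ne hne)
  have hl : ∀ a ∈ level u {b, t} p (s + 1), a b + a t = s + 1 := fun a ha => by
    have := mem_level.1 ha
    rw [sum_pair hbt] at this
    exact this.2.2
  have hzb : ∀ a ∈ A, a b ≠ z b := fun a ha h =>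
    hzA (eq_of_mem_level_pair hbt (hA ha) hz h ▸ ha)
  have hzl := hl z hz
  refine card_le_card_of_injOn (fun a => a - Finsupp.single (if z b < a b then b else t) 1)
    (fun a ha => ?_) fun a ha a' ha' h => ?_
  · have h1 := hzb a ha
    have h2 := hl a (hA ha)
    by_cases h : z b < a b
    · simpa only [h, if_true, mem_coe] using sub_single_mem_lowerShadow (by simp) ha (by omega)
    · simpa only [h, if_false, mem_coe] using sub_single_mem_lowerShadow (by simp) ha (by omega)
  · refine eq_of_mem_level_pair hbt (hA ha) (hA ha') ?_
    have h1 := hzb a ha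
    have h2 := hzb a' ha'
    have h3 := DFunLike.congr_fun h b
    by_cases h4 : z b < a b <;> by_cases h5 : z b < a' b <;>
      simp [h4, h5, hbt] at h3 <;> omega

lemma initSegMinimizesShadow_pair (hbt : pos b < pos t) (hB : ∀ v, u v < B) (hB2 : 2 ≤ B)
    (hu : u t ≤ u b) : InitSegMinimizesShadow u (wt B pos) {b, t} := by
  intro p s A hA
  have hbt' : b ≠ t := by rintro rfl; exact hbt.false
  have hpos : Set.InjOn pos ({b, t} : Finset V) := by
    intro v hv w hw h
    simp only [coe_insert, coe_singleton, Set.mem_insert_iff, Set.mem_singleton_iff] at hv hw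
    rcases hv with rfl | rfl <;> rcases hw with rfl | rfl <;> first | rfl | omega
  rcases A.eq_empty_or_nonempty with rfl | hne
  · exact ⟨∅, ⟨by simp, by simp⟩, rfl, le_rfl⟩
  by_cases hfull : A = level u {b, t} p (s + 1)
  · exact ⟨A, ⟨hA, fun _ _ q hq _ => hfull ▸ hq⟩, rfl, le_rfl⟩
  have hinj : Set.InjOn (wt B pos) (level u {b, t} p (s + 1)) := by
    obtain ⟨a, ha⟩ := hne
    rw [← fiber_eq_level (hA ha)]
    exact injOn_wt_fiber hpos hB a
  set J := initSeg (wt B pos) (level u {b, t} p (s + 1)) #A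
  have hJ : IsInitSeg (wt B pos) (level u {b, t} p (s + 1)) J := isInitSeg_initSeg
  have hJc : #J = #A := card_initSeg hinj (card_le_card hA)
  refine ⟨J, hJ, hJc, ?_⟩
  have hsh : ∀ z ∈ lowerShadow {b, t} J, z b < u b → z + Finsupp.single b 1 ∈ J := by
    intro z hz hzu
    have hzl := lowerShadow_subset_level hJ.1 hz
    obtain ⟨v, hv, hzv⟩ := mem_lowerShadow.1 hz
    rw [mem_insert, mem_singleton] at hv
    rcases hv with rfl | rfl
    · exact hzv
    · refine hJ.2 _ hzv _ (add_single_mem_level (by simp) hzl hzu) ?_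
      rw [wt_add_single, wt_add_single]
      exact Nat.add_lt_add_left (Nat.pow_lt_pow_right hB2 hbt) _
  have hlow : #((lowerShadow {b, t} J).filter fun z => z b < u b) ≤ #A := by
    rw [← hJc]
    refine card_le_card_of_injOn (· + Finsupp.single b 1) (fun z hz => ?_)
      (add_left_injective _).injOn
    rw [mem_coe, mem_filter] at hz
    exact hsh z hz.1 hz.2
  have hhigh : #((lowerShadow {b, t} J).filter fun z => ¬ z b < u b) ≤ 1 := by
    refine card_le_one.2 fun z hz z' hz' => ?_
    rw [mem_filter] at hz hz'
    have h1 := lowerShadow_subset_level hJ.1 hz.1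
    have h2 := lowerShadow_subset_level hJ.1 hz'.1
    refine eq_of_mem_level_pair hbt' h1 h2 ?_
    have := (mem_level.1 h1).1 b
    have := (mem_level.1 h2).1 b
    omega
  have hsplit := card_filter_add_card_filter_not (s := lowerShadow {b, t} J) fun z => z b < u b
  rcases le_or_gt (u b) s with hs | hs
  · have := card_lt_card_lowerShadow_pair hbt' hA hne hs (hu.trans hs)
    omega
  · have := card_le_card_lowerShadow_pair hbt' hA hfull
    have h0 : (lowerShadow {b, t} J).filter (fun z => ¬ z b < u b) = ∅ := by
      refine filter_eq_empty_iff.2 fun z hz => not_not.2 ?_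
      have := (mem_level.1 (lowerShadow_subset_level hJ.1 hz)).2.2
      rw [sum_pair hbt'] at this
      omega
    rw [h0, card_empty] at hsplit
    omega

/-- In a set compressed along each coordinate hyperplane of a block of at least three variables,
a gap `x` below a member `y` has a smaller exponent than `y` in the lowest variable. -/
lemma lt_of_gap (hpos : Set.InjOn pos T) (hB : ∀ v, u v < B)
    (hu : ∀ v ∈ T, ∀ w ∈ T, pos v ≤ pos w → u w ≤ u v) (hcard : 3 ≤ #T)
    (hb : b ∈ T) (hbmin : ∀ v ∈ T, v ≠ b → pos b < pos v)
    (ht : t ∈ T) (htmax : ∀ v ∈ T, v ≠ t → pos v < pos t)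
    (hA : A ⊆ level u T p s)
    (hcomp : ∀ i ∈ T, ∀ y ∈ A, ∀ x ∈ level u T p s, x i = y i → wt B pos x ≤ wt B pos y → x ∈ A)
    (hx : x ∈ level u T p s) (hxA : x ∉ A) (hy : y ∈ A) (hlt : wt B pos x < wt B pos y) :
    x b < y b := by
  by_contra! hyx
  have hxl := mem_level.1 hx
  have hyl := mem_level.1 (hA hy)
  have hup : ∀ w ∈ T, ¬ pos t < pos w := fun w hw h => by
    by_cases hwt : w = t
    · subst hwt; exact h.false
    · exact h.not_gt (htmax w hw hwt)
  have hltB : ∀ q ∈ level u T p s, ∀ v, q v < B := fun q hq v =>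
    ((mem_level.1 hq).1 v).trans_lt (hB v)
  have hoff : ∀ q ∈ level u T p s, ∀ r ∈ level u T p s, ∀ v ∉ T, q v = r v :=
    fun q hq r hr v hv => ((mem_level.1 hq).2.1 v hv).trans ((mem_level.1 hr).2.1 v hv).symm
  have hwlt : ∀ q ∈ level u T p s, ∀ r ∈ level u T p s, q t < r t → wt B pos q < wt B pos r :=
    fun q hq r hr h => wt_lt_of_lex hpos (hltB q hq) (hoff q hq r hr) ht h
      fun w hw h' => absurd h' (hup w hw)
  have hxyt : x t < y t := by
    refine lt_of_le_of_ne (not_lt.1 fun h => ?_) fun h => hxA (hcomp t ht y hy x hx h hlt.le)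
    exact hlt.not_gt (hwlt y (hA hy) x hx h)
  obtain ⟨c, hc⟩ : ((T.erase b).erase t).Nonempty := by
    rw [← card_pos]
    have h1 := pred_card_le_card_erase (s := T) (a := b)
    have h2 := pred_card_le_card_erase (s := T.erase b) (a := t)
    omega
  have hbt : t ≠ b := by
    rintro rfl
    have hc' := mem_of_mem_erase hc
    exact hup c (mem_of_mem_erase hc') (hbmin c (mem_of_mem_erase hc') (ne_of_mem_erase hc'))
  set mid := (T.erase b).erase t with hmid
  have hmem : ∀ v, v ∈ mid ↔ v ∈ T ∧ v ≠ b ∧ v ≠ t := fun v => by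
    rw [hmid, mem_erase, mem_erase]; tauto
  have hsplit : ∀ f : V →₀ ℕ, ∑ v ∈ T, f v = f b + f t + ∑ v ∈ mid, f v := fun f => by
    rw [← add_sum_erase T _ hb, ← add_sum_erase (T.erase b) _ (mem_erase.2 ⟨hbt, ht⟩), add_assoc]
  have hcu : u t ≤ ∑ v ∈ mid, u v := by
    have hcT := (hmem c).1 hc
    exact (hu c hcT.1 t ht (htmax c hcT.1 hcT.2.2).le).trans
      (single_le_sum (f := fun v => u v) (fun _ _ => Nat.zero_le _) hc)
  have hxu : ∑ v ∈ mid, x v ≤ ∑ v ∈ mid, u v := sum_le_sum fun v _ => hxl.1 v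
  have hyt : y t ≤ u t := hyl.1 t
  have hxs := hsplit x
  have hys := hsplit y
  rw [hxl.2.2] at hxs
  rw [hyl.2.2] at hys
  obtain ⟨k, hk1, hk2, hk3, hk4⟩ : ∃ k, y b ≤ k ∧ k ≤ x b ∧
      x b + ∑ v ∈ mid, x v ≤ k + ∑ v ∈ mid, u v ∧ k ≤ y b + ∑ v ∈ mid, y v :=
    ⟨max (y b) (x b - (∑ v ∈ mid, u v - ∑ v ∈ mid, x v)), by omega, by omega, by omega, by omega⟩
  have hbmid : b ∉ mid := fun h => ((hmem b).1 h).2.1 rfl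
  have htmid : t ∉ mid := fun h => ((hmem t).1 h).2.2 rfl
  -- a monomial above `x`, hence outside `A`, with exponent `k` at `b`
  obtain ⟨z, hz, hzb, hzA⟩ : ∃ z ∈ level u T p s, z b = k ∧ z t = x t ∧ z ∉ A := by
    have hlo : ∀ v, x.update b k v = if v = b then k else x v := fun v => by
      simp [Finsupp.update_apply]
    have hhi : ∀ v, (x.update b k ⊔ u.filter (· ∈ mid)) v =
        if v = b then k else if v ∈ mid then u v else x v := fun v => by
      rw [Finsupp.sup_apply, hlo, Finsupp.filter_apply]
      by_cases h1 : v = b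
      · subst h1; simp [hbmid]
      · by_cases h2 : v ∈ mid
        · simpa [h1, h2] using hxl.1 v
        · simp [h1, h2]
    obtain ⟨z, hz1, hz2, hz3⟩ := exists_between_sum_eq (T := T) (s := s)
      (le_sup_left : x.update b k ≤ x.update b k ⊔ u.filter (· ∈ mid))
      (by
        have hs : ∑ v ∈ mid, x.update b k v = ∑ v ∈ mid, x v := sum_congr rfl fun v hv =>
          (hlo v).trans (if_neg (by rintro rfl; exact hbmid hv))
        rw [hsplit, hs, hlo, hlo, if_pos rfl, if_neg hbt]
        omega)
      (by
        have hs : ∑ v ∈ mid, (x.update b k ⊔ u.filter (· ∈ mid)) v = ∑ v ∈ mid, u v :=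
          sum_congr rfl fun v hv => (hhi v).trans
            ((if_neg (by rintro rfl; exact hbmid hv)).trans (if_pos hv))
        rw [hsplit, hs, hhi, hhi, if_pos rfl,
          if_neg hbt, if_neg htmid]
        omega)
    have hz1' : ∀ v, (if v = b then k else x v) ≤ z v := fun v => hlo v ▸ hz1 v
    have hz2' : ∀ v, z v ≤ if v = b then k else if v ∈ mid then u v else x v :=
      fun v => hhi v ▸ hz2 v
    have hzb : z b = k := by
      have h1 := hz1' b
      have h2 := hz2' b
      rw [if_pos rfl] at h1 h2
      omega
    have hzx : ∀ v, v ≠ b → v ∉ mid → z v = x v := fun v h h' => by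
      have h1 := hz1' v
      have h2 := hz2' v
      rw [if_neg h] at h1
      rw [if_neg h, if_neg h'] at h2
      omega
    have hzl : z ∈ level u T p s := by
      refine mem_level.2 ⟨fun v => ?_, fun v hv => ?_, hz3⟩
      · by_cases h1 : v = b
        · subst h1; rw [hzb]; exact hk2.trans (hxl.1 v)
        · by_cases h2 : v ∈ mid
          · have := hz2' v
            rwa [if_neg h1, if_pos h2] at this
          · rw [hzx v h1 h2]; exact hxl.1 v
      · rw [hzx v (by rintro rfl; exact hv hb) fun h => hv ((hmem v).1 h).1, hxl.2.1 v hv]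
    have hzt := hzx t hbt htmid
    refine ⟨z, hzl, hzb, hzt, fun hzA => hxA (hcomp t ht z hzA x hx hzt.symm ?_)⟩
    refine wt_le_of_le_off_min hpos (hltB x hx) (hoff x hx z hzl) (hxl.2.2.trans hz3.symm) hb hbmin
      fun v _ hvb => ?_
    have := hz1' v
    rwa [if_neg hvb] at this
  -- a monomial below `y`, hence in `A`, with exponent `k` at `b`
  obtain ⟨w, hw, hwb, hwt, hwA⟩ : ∃ w ∈ level u T p s, w b = k ∧ w t = y t ∧ w ∈ A := by
    have hhi : ∀ v, y.update b k v = if v = b then k else y v := fun v => by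
      simp [Finsupp.update_apply]
    have hlo : ∀ v, (y.update b k).filter (· ∉ mid) v =
        if v ∈ mid then 0 else if v = b then k else y v := fun v => by
      rw [Finsupp.filter_apply, hhi]
      by_cases h : v ∈ mid <;> simp [h]
    obtain ⟨w, hw1, hw2, hw3⟩ := exists_between_sum_eq (T := T) (s := s)
      (f := (y.update b k).filter (· ∉ mid)) (g := y.update b k)
      (fun v => by
        rw [hlo, hhi]
        by_cases h : v ∈ mid <;> simp [h])
      (by
        rw [hsplit, sum_congr rfl fun v (hv : v ∈ mid) => (hlo v).trans (if_pos hv), hlo, hlo,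
          if_neg hbmid, if_neg htmid, if_pos rfl, if_neg hbt, sum_const_zero]
        omega)
      (by
        have hs : ∑ v ∈ mid, y.update b k v = ∑ v ∈ mid, y v := sum_congr rfl fun v hv =>
          (hhi v).trans (if_neg (by rintro rfl; exact hbmid hv))
        rw [hsplit, hs, hhi, hhi, if_pos rfl, if_neg hbt]
        omega)
    have hw1' : ∀ v, (if v ∈ mid then 0 else if v = b then k else y v) ≤ w v :=
      fun v => hlo v ▸ hw1 v
    have hw2' : ∀ v, w v ≤ if v = b then k else y v := fun v => hhi v ▸ hw2 v
    have hwb : w b = k := by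
      have h1 := hw1' b
      have h2 := hw2' b
      rw [if_neg hbmid, if_pos rfl] at h1
      rw [if_pos rfl] at h2
      omega
    have hwy : ∀ v, v ≠ b → v ∉ mid → w v = y v := fun v h h' => by
      have h1 := hw1' v
      have h2 := hw2' v
      rw [if_neg h', if_neg h] at h1
      rw [if_neg h] at h2
      omega
    have hwle : ∀ v, v ≠ b → w v ≤ y v := fun v h => by
      have := hw2' v
      rwa [if_neg h] at this
    have hwl : w ∈ level u T p s := by
      refine mem_level.2 ⟨fun v => ?_, fun v hv => ?_, hw3⟩
      · by_cases h1 : v = b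
        · subst h1; rw [hwb]; exact hk2.trans (hxl.1 v)
        · exact (hwle v h1).trans (hyl.1 v)
      · rw [hwy v (by rintro rfl; exact hv hb) fun h => hv ((hmem v).1 h).1, hyl.2.1 v hv]
    have hwt := hwy t hbt htmid
    exact ⟨w, hwl, hwb, hwt, hcomp t ht y hy w hwl hwt (wt_le_of_le_off_min hpos (hltB w hwl)
      (hoff w hwl y (hA hy)) (hw3.trans hyl.2.2.symm) hb hbmin fun v _ hvb => hwle v hvb)⟩
  exact hzA.2 (hcomp b hb w hwA z hz (hzb.trans hwb.symm)
    (hwlt z hz w hw (by rw [hzA.1, hwt]; exact hxyt)).le)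

/-- Exchanging the last member `y` of `A` for the first gap `x` does not enlarge the shadow. -/
lemma card_lowerShadow_exchange_le (hB2 : 2 ≤ B) (hb : b ∈ T)
    (hbmin : ∀ v ∈ T, v ≠ b → pos b < pos v) (hA : A ⊆ level u T p (s + 1))
    (hx : x ∈ level u T p (s + 1))
    (hxmin : ∀ z ∈ level u T p (s + 1), wt B pos z < wt B pos x → z ∈ A)
    (hy : y ∈ A) (hymax : ∀ z ∈ A, wt B pos z ≤ wt B pos y)
    (hlt : wt B pos x < wt B pos y) (hxy : x b < y b) :
    #(lowerShadow T (insert x (A.erase y))) ≤ #(lowerShadow T A) := by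
  have hy' : y - Finsupp.single b 1 + Finsupp.single b 1 = y := by
    refine tsub_add_cancel_of_le ?_
    exact Finsupp.single_le_iff.2 ((Nat.zero_le _).trans_lt hxy)
  have hmove : ∀ (z : V →₀ ℕ) (i : V), i ∈ T → i ≠ b →
      wt B pos (z + Finsupp.single b 1) < wt B pos (z + Finsupp.single i 1) := fun z i hi hib => by
    rw [wt_add_single, wt_add_single]
    exact Nat.add_lt_add_left (Nat.pow_lt_pow_right hB2 (hbmin i hi hib)) _
  have hsub : lowerShadow T (insert x (A.erase y)) ⊆
      insert (x - Finsupp.single b 1) ((lowerShadow T A).erase (y - Finsupp.single b 1)) := by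
    intro z hz
    obtain ⟨i, hi, hzi⟩ := mem_lowerShadow.1 hz
    rw [mem_insert, mem_erase] at hzi ⊢
    by_cases hib : i = b
    · subst hib
      rcases hzi with h | h
      · left; rw [← h]; simp
      · refine .inr ⟨?_, mem_lowerShadow.2 ⟨i, hi, h.2⟩⟩
        rintro rfl
        exact h.1 hy'
    · have hm := hmove z i hi hib
      rcases hzi with h | h
      · rw [h] at hm
        have hzb : z b ≤ x b := by rw [← h]; simp
        have hzl : z ∈ level u T p s := mem_level_of_add_single hi (h ▸ hx)
        have hzA := hxmin _ (add_single_mem_level hb hzl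
          (hzb.trans_lt (hxy.trans_le ((mem_level.1 (hA hy)).1 b)))) hm
        refine .inr ⟨?_, mem_lowerShadow.2 ⟨b, hb, hzA⟩⟩
        rintro rfl
        rw [hy'] at hm
        exact hm.not_gt hlt
      · refine .inr ⟨?_, mem_lowerShadow.2 ⟨i, hi, h.2⟩⟩
        rintro rfl
        rw [hy'] at hm
        exact hm.not_ge (hymax _ h.2)
  have hmem : y - Finsupp.single b 1 ∈ lowerShadow T A :=
    mem_lowerShadow.2 ⟨b, hb, hy'.symm ▸ hy⟩
  calc _ ≤ _ := card_le_card hsub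
    _ ≤ _ := card_insert_le _ _
    _ = _ := card_erase_add_one hmem

lemma eq_of_le_of_mem_level (hx : x ∈ level u T p s) (hy : y ∈ level u T p s) (h : x ≤ y) :
    x = y := by
  rw [mem_level] at hx hy
  ext v
  by_cases hv : v ∈ T
  · exact (sum_eq_sum_iff_of_le fun w _ => h w).1 (hx.2.2.trans hy.2.2.symm) v hv
  · rw [hx.2.1 v hv, hy.2.1 v hv]

lemma mem_level_iff_of_mem_fiber {T' : Finset V} (hT' : T' ⊆ T) (hx : x ≤ u)
    (hy : y ∈ fiber u T' x) : y ∈ level u T p s ↔ x ∈ level u T p s := by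
  rw [mem_fiber] at hy
  have hsum : ∑ v ∈ T, y v = ∑ v ∈ T, x v := by
    rw [← sum_sdiff hT', ← sum_sdiff (f := fun v => x v) hT', hy.2.2]
    congr 1
    exact sum_congr rfl fun v hv => hy.2.1 v (mem_sdiff.1 hv).2
  have hoff : ∀ v ∉ T, y v = x v := fun v hv => hy.2.1 v fun h => hv (hT' h)
  rw [mem_level, mem_level, hsum]
  refine and_congr (iff_of_true hy.1 hx) (and_congr_left fun _ => forall₂_congr fun v hv => ?_)
  rw [hoff v hv]

/-- Compressing a subblock does not enlarge the shadow. -/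
lemma lowerShadow_compress {T' : Finset V} (hT' : T' ⊆ T) (hpos : Set.InjOn pos T')
    (hB : ∀ v, u v < B) (hmin : InitSegMinimizesShadow u (wt B pos) T')
    (hA : A ⊆ level u T p (s + 1)) :
    compress u (wt B pos) T' A ⊆ level u T p (s + 1) ∧
      #(lowerShadow T (compress u (wt B pos) T' A)) ≤ #(lowerShadow T A) := by
  classical
  set M := A.biUnion Iic with hM
  have hMu : M ⊆ Iic u := by
    intro q hq
    obtain ⟨a, ha, hqa⟩ := mem_biUnion.1 hq
    exact mem_Iic.2 ((mem_Iic.1 hqa).trans (mem_level.1 (hA ha)).1)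
  have hMlow : IsLowerSet (M : Set (V →₀ ℕ)) := by
    intro q r hrq hq
    obtain ⟨a, ha, hqa⟩ := mem_biUnion.1 hq
    exact mem_biUnion.2 ⟨a, ha, mem_Iic.2 (hrq.trans (mem_Iic.1 hqa))⟩
  have hMA : M.filter (· ∈ level u T p (s + 1)) = A := by
    ext q
    rw [mem_filter]
    constructor
    · rintro ⟨hq, hql⟩
      obtain ⟨a, ha, hqa⟩ := mem_biUnion.1 hq
      rwa [eq_of_le_of_mem_level hql (hA ha) (mem_Iic.1 hqa)]
    · exact fun hq => ⟨mem_biUnion.2 ⟨q, hq, mem_Iic.2 le_rfl⟩, hA hq⟩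
  have hMG : M.filter (· ∈ level u T p s) ⊆ lowerShadow T A := by
    intro q hq
    obtain ⟨hq, hql⟩ := mem_filter.1 hq
    obtain ⟨a, ha, hqa⟩ := mem_biUnion.1 hq
    have hqa := mem_Iic.1 hqa
    have hal := mem_level.1 (hA ha)
    obtain ⟨v, hv, hlt⟩ := exists_lt_of_sum_lt (s := T) (f := q) (g := a)
      (by rw [hal.2.2, (mem_level.1 hql).2.2]; omega)
    refine mem_lowerShadow.2 ⟨v, hv, ?_⟩
    rwa [eq_of_le_of_mem_level (add_single_mem_level hv hql (hlt.trans_le (hal.1 v))) (hA ha)]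
    intro w
    by_cases hw : v = w
    · subst hw; simpa using hlt
    · simpa [Finsupp.single_apply, hw] using hqa w
  have hlow := hmin.isLowerSet_compress hpos hB hMlow
  have hinv : ∀ s', ∀ q, q ≤ u → ∀ r ∈ fiber u T' q,
      (r ∈ level u T p s' ↔ q ∈ level u T p s') :=
    fun s' q hq r hr => mem_level_iff_of_mem_fiber hT' hq hr
  have hCA : compress u (wt B pos) T' A =
      (compress u (wt B pos) T' M).filter (· ∈ level u T p (s + 1)) := by
    rw [← compress_filter (P := fun q => q ∈ level u T p (s + 1)) (hinv _), hMA]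
  have hsub : compress u (wt B pos) T' A ⊆ level u T p (s + 1) := fun q hq => by
    rw [hCA] at hq
    exact (mem_filter.1 hq).2
  refine ⟨hsub, ?_⟩
  calc _ ≤ #((compress u (wt B pos) T' M).filter (· ∈ level u T p s)) := by
        refine card_le_card fun q hq => mem_filter.2 ⟨?_, lowerShadow_subset_level hsub hq⟩
        obtain ⟨v, hv, hqv⟩ := mem_lowerShadow.1 hq
        rw [hCA] at hqv
        exact hlow (le_self_add : q ≤ _) (mem_filter.1 hqv).1
    _ = #(M.filter (· ∈ level u T p s)) := by
        rw [← compress_filter (P := fun q => q ∈ level u T p s) (hinv _),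
          card_compress (injOn_wt_fiber hpos hB) ((filter_subset _ _).trans hMu)]
    _ ≤ _ := card_le_card hMG

/-- The **Clements–Lindström theorem**: if the exponent bounds decrease along the block `T`, then
lexicographic initial segments minimize lower shadows. -/
theorem initSegMinimizesShadow (hB : ∀ v, u v < B) (hB2 : 2 ≤ B) (hpos : Set.InjOn pos T)
    (hu : ∀ v ∈ T, ∀ w ∈ T, pos v ≤ pos w → u w ≤ u v) :
    InitSegMinimizesShadow u (wt B pos) T := by
  classical
  induction hn : #T using Nat.strong_induction_on generalizing T with
  | _ n ih =>
  subst hn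
  rcases le_or_gt #T 1 with hT1 | hT1
  · exact initSegMinimizesShadow_of_card_le_one hT1
  rcases (Nat.succ_le_of_lt hT1).lt_or_eq with hT2 | hT2
  swap
  · obtain ⟨b, t, hbt, rfl⟩ := card_eq_two.1 hT2.symm
    rcases lt_trichotomy (pos b) (pos t) with h | h | h
    · exact initSegMinimizesShadow_pair h hB hB2 (hu b (by simp) t (by simp) h.le)
    · exact absurd (hpos (by simp) (by simp) h) hbt
    · rw [pair_comm]
      exact initSegMinimizesShadow_pair h hB hB2 (hu t (by simp) b (by simp) h.le)
  intro p s A hA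
  have hne : T.Nonempty := card_pos.1 (by omega)
  obtain ⟨b, hb, hbmin⟩ := exists_min_image T pos hne
  obtain ⟨t, ht, htmax⟩ := exists_max_image T pos hne
  replace hbmin : ∀ v ∈ T, v ≠ b → pos b < pos v := fun v hv hvb =>
    (hbmin v hv).lt_of_ne fun h => hvb (hpos hv hb h.symm)
  replace htmax : ∀ v ∈ T, v ≠ t → pos v < pos t := fun v hv hvt =>
    (htmax v hv).lt_of_ne fun h => hvt (hpos hv ht h)
  obtain ⟨I, hI, hImin⟩ := exists_min_image
    ((level u T p (s + 1)).powerset.filter fun I => #I = #A ∧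
      #(lowerShadow T I) ≤ #(lowerShadow T A)) (fun I => ∑ q ∈ I, wt B pos q)
    ⟨A, mem_filter.2 ⟨mem_powerset.2 hA, rfl, le_rfl⟩⟩
  simp only [mem_filter, mem_powerset] at hI hImin
  obtain ⟨hIF, hIc, hIs⟩ := hI
  have hIu : I ⊆ Iic u := fun q hq => mem_Iic.2 (mem_level.1 (hIF hq)).1
  have hcomp : ∀ i ∈ T, ∀ y ∈ I, ∀ x ∈ level u T p (s + 1), x i = y i →
      wt B pos x ≤ wt B pos y → x ∈ I := by
    intro i hi y hy x hx hxy hle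
    have hpos' : Set.InjOn pos (T.erase i) := hpos.mono (erase_subset _ _)
    have hsmall := ih #(T.erase i) (card_erase_lt_of_mem hi) hpos'
      (fun v hv w hw => hu v (mem_of_mem_erase hv) w (mem_of_mem_erase hw)) rfl
    obtain ⟨h1, h2⟩ := lowerShadow_compress (erase_subset i T) hpos' hB hsmall hIF
    have hfix : compress u (wt B pos) (T.erase i) I = I := by
      by_contra h
      refine (sum_compress_lt (injOn_wt_fiber hpos' hB) hIu h).not_ge (hImin _ ⟨h1, ?_, ?_⟩)
      · rw [card_compress (injOn_wt_fiber hpos' hB) hIu, hIc]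
      · exact h2.trans hIs
    refine mem_of_compress_eq hfix hy (mem_fiber.2 ?_) hle
    have hyl := mem_level.1 (hIF hy)
    rw [mem_level] at hx
    refine ⟨hx.1, fun v hv => ?_, ?_⟩
    · by_cases hvi : v = i
      · rw [hvi, hxy]
      · have hvT : v ∉ T := fun h => hv (mem_erase.2 ⟨hvi, h⟩)
        rw [hx.2.1 v hvT, hyl.2.1 v hvT]
    · have := hx.2.2.trans hyl.2.2.symm
      rw [← add_sum_erase T _ hi, ← add_sum_erase T (fun v => y v) hi] at this
      omega
  refine ⟨I, ⟨hIF, fun y₀ hy₀ x₀ hx₀ hlt₀ => ?_⟩, hIc, hIs⟩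
  by_contra hx₀I
  obtain ⟨x, hx, hxmin⟩ := exists_min_image (level u T p (s + 1) \ I) (wt B pos)
    ⟨x₀, mem_sdiff.2 ⟨hx₀, hx₀I⟩⟩
  obtain ⟨y, hy, hymax⟩ := exists_max_image I (wt B pos) ⟨y₀, hy₀⟩
  have hlt : wt B pos x < wt B pos y :=
    (hxmin x₀ (mem_sdiff.2 ⟨hx₀, hx₀I⟩)).trans_lt (hlt₀.trans_le (hymax y₀ hy₀))
  obtain ⟨hxF, hxI⟩ := mem_sdiff.1 hx
  have hxy := lt_of_gap hpos hB hu hT2 hb hbmin ht htmax hIF hcomp hxF hxI hy hlt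
  have hex := card_lowerShadow_exchange_le hB2 hb hbmin hIF hxF
    (fun z hz hzx => by_contra fun h => hzx.not_ge (hxmin z (mem_sdiff.2 ⟨hz, h⟩)))
    hy hymax hlt hxy
  have hxe : x ∉ I.erase y := fun h => hxI (mem_of_mem_erase h)
  have := hImin (insert x (I.erase y))
    ⟨insert_subset hxF ((erase_subset _ _).trans hIF),
      by rw [card_insert_of_notMem hxe, card_erase_add_one hy, hIc], hex.trans hIs⟩
  rw [sum_insert hxe, ← add_sum_erase I _ hy] at this
  omega

end ClementsLindstrom

section FullCompression

variable {V ι β : Type*} [DecidableEq V] [DecidableEq β] {u : V →₀ ℕ} {T : ι → Finset V}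
  {M : Finset (V →₀ ℕ)} {pos : V → ℕ} {B : ℕ}

/-- A lower set can be compressed simultaneously along several blocks of variables, preserving
any statistic that is constant on the fibers of each block. -/
theorem exists_isLowerSet_forall_compress_eq (hB : ∀ v, u v < B) (hB2 : 2 ≤ B)
    (hpos : ∀ i, Set.InjOn pos (T i))
    (hu : ∀ i, ∀ v ∈ T i, ∀ w ∈ T i, pos v ≤ pos w → u w ≤ u v)
    (deg : (V →₀ ℕ) → β) (hdeg : ∀ i p, p ≤ u → ∀ q ∈ fiber u (T i) p, deg q = deg p)
    (hMu : M ⊆ Iic u) (hM : IsLowerSet (M : Set (V →₀ ℕ))) :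
    ∃ M' : Finset (V →₀ ℕ), M' ⊆ Iic u ∧ IsLowerSet (M' : Set (V →₀ ℕ)) ∧
      (∀ i, compress u (wt B pos) (T i) M' = M') ∧
      ∀ b, #(M'.filter (deg · = b)) = #(M.filter (deg · = b)) := by
  classical
  obtain ⟨M', hM', hmin⟩ := exists_min_image
    ((Iic u).powerset.filter fun M' : Finset (V →₀ ℕ) => IsLowerSet (M' : Set (V →₀ ℕ)) ∧
      ∀ b, #(M'.filter (deg · = b)) = #(M.filter (deg · = b)))
    (fun M' => ∑ q ∈ M', wt B pos q)
    ⟨M, mem_filter.2 ⟨mem_powerset.2 hMu, hM, fun _ => rfl⟩⟩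
  simp only [mem_filter, mem_powerset] at hM' hmin
  obtain ⟨hMu', hlow, hcard⟩ := hM'
  refine ⟨M', hMu', hlow, fun i => ?_, hcard⟩
  have hinj := injOn_wt_fiber (hpos i) hB
  by_contra h
  refine (sum_compress_lt hinj hMu' h).not_ge (hmin _ ⟨compress_subset,
    (initSegMinimizesShadow hB hB2 (hpos i) (hu i)).isLowerSet_compress (hpos i) hB hlow,
    fun b => ?_⟩)
  rw [← compress_filter fun p hp q hq => by rw [hdeg i p hp q hq],
    card_compress hinj ((filter_subset _ _).trans hMu'), hcard]

end FullCompression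

section Degree

variable {n : ℕ} {t : Fin n} {m p q : MCMon n}

lemma degOn_eq_sum {T : Finset (Fin n × ℕ)} (hT : ∀ v ∈ T, v.1 = t)
    (hm : ∀ v, v.1 = t → m v ≠ 0 → v ∈ T) : degOn t m = ∑ v ∈ T, m v := by
  rw [degOn, ← sum_filter]
  refine sum_subset (fun v hv => ?_) fun v hv hv' => ?_
  · rw [mem_filter, Finsupp.mem_support_iff] at hv
    exact hm v hv.2 hv.1
  · by_contra h
    exact hv' (mem_filter.2 ⟨Finsupp.mem_support_iff.2 h, hT v hv⟩)

lemma degOn_congr (h : ∀ j, p (t, j) = q (t, j)) : degOn t p = degOn t q := by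
  have hpq : ∀ v : Fin n × ℕ, v.1 = t → p v = q v := by
    rintro ⟨i, j⟩ rfl
    exact h j
  have hT : ∀ v ∈ p.support.filter (·.1 = t), v.1 = t := fun v hv => (mem_filter.1 hv).2
  rw [degOn_eq_sum hT fun v hv hne => mem_filter.2 ⟨Finsupp.mem_support_iff.2 hne, hv⟩,
    degOn_eq_sum hT fun v hv hne => mem_filter.2
      ⟨Finsupp.mem_support_iff.2 ((hpq v hv).trans_ne hne), hv⟩]
  exact sum_congr rfl fun v hv => hpq v (hT v hv)

lemma totalDeg_eq_degOn (h : ∀ v ∈ m.support, v.1 = t) : totalDeg m = degOn t m :=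
  sum_congr rfl fun v hv => (if_pos (h v hv)).symm

lemma le_degOn (v : Fin n × ℕ) (m : MCMon n) : m v ≤ degOn v.1 m := by
  by_cases h : m v = 0
  · simp [h]
  · refine (if_pos rfl).ge.trans (single_le_sum
      (f := fun w : Fin n × ℕ => if w.1 = v.1 then m w else 0)
      (fun _ _ => Nat.zero_le _) (Finsupp.mem_support_iff.2 h))

end Degree

section Box

variable {n : ℕ} {S : Fin n → Set ℕ} {e : Fin n → ℕ → ℕ∞} {N D : ℕ} {t : Fin n} {p q : MCMon n}

open Classical in
/-- The largest monomial within the bounds `e` in the variables of position less than `N`,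
with all exponents at most `D`. -/
noncomputable def boxMon (S : Fin n → Set ℕ) (e : Fin n → ℕ → ℕ∞) (N D : ℕ) : MCMon n :=
  Finsupp.onFinset (univ ×ˢ range N)
    (fun v => if v.2 < N ∧ v.2 ∈ S v.1 then (min (e v.1 v.2) D).toNat else 0)
    fun v hv => by
      simp only [ne_eq, ite_eq_right_iff, not_forall] at hv
      exact mem_product.2 ⟨mem_univ _, mem_range.2 hv.1.1⟩

lemma le_boxMon_iff :
    p ≤ boxMon S e N D ↔ InBounds S e p ∧ ∀ v, p v ≠ 0 → v.2 < N ∧ p v ≤ D := by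
  classical
  have key : ∀ v, p v ≤ boxMon S e N D v ↔
      (p v ≠ 0 → (v.2 ∈ S v.1 ∧ (p v : ℕ∞) ≤ e v.1 v.2) ∧ v.2 < N ∧ p v ≤ D) := fun v => by
    have hfin : min (e v.1 v.2) (D : ℕ∞) ≠ ⊤ := ne_top_of_le_ne_top (ENat.natCast_ne_top D)
      (min_le_right _ _)
    rw [boxMon, Finsupp.onFinset_apply]
    split_ifs with h
    · rw [← ENat.natCast_le_natCast, ENat.natCast_toNat hfin, le_min_iff, ENat.natCast_le_natCast]
      constructor
      · exact fun h' _ => ⟨⟨h.2, h'.1⟩, h.1, h'.2⟩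
      · intro h'
        by_cases h0 : p v = 0
        · simp [h0]
        · exact ⟨(h' h0).1.2, (h' h0).2.2⟩
    · rw [Nat.le_zero]
      constructor
      · exact fun h0 h0' => absurd h0 h0'
      · intro h'
        by_contra h0
        exact h ⟨(h' h0).2.1, (h' h0).1.1⟩
  constructor
  · exact fun h => ⟨fun i j hij => ((key (i, j)).1 (h _) hij).1, fun v hv => ((key v).1 (h _) hv).2⟩
  · exact fun h v => (key v).2 fun hv => ⟨h.1 v.1 v.2 hv, h.2 v hv⟩

lemma boxMon_le (v : Fin n × ℕ) : boxMon S e N D v ≤ D := by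
  by_cases h : boxMon S e N D v = 0
  · simp [h]
  · exact ((le_boxMon_iff.1 le_rfl).2 v h).2

lemma boxMon_anti (hmono : ∀ i, ∀ j ∈ S i, ∀ k ∈ S i, j ≤ k → e i k ≤ e i j) {j k : ℕ}
    (hj : j ∈ S t) (hjk : j ≤ k) : boxMon S e N D (t, k) ≤ boxMon S e N D (t, j) := by
  by_cases h0 : boxMon S e N D (t, k) = 0
  · simp [h0]
  have hk := (le_boxMon_iff.1 (le_refl (boxMon S e N D))).1 t k h0
  have hk' := (le_boxMon_iff.1 (le_refl (boxMon S e N D))).2 (t, k) h0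
  have := (le_boxMon_iff (S := S) (e := e) (N := N) (D := D)
    (p := Finsupp.single (t, j) (boxMon S e N D (t, k)))).2 ⟨fun i l h => ?_, fun v h => ?_⟩
  · simpa using this (t, j)
  · obtain ⟨rfl, rfl, -⟩ : t = i ∧ j = l ∧ _ := by
      simpa [Finsupp.single_apply] using h
    simpa using ⟨hj, hk.2.trans (hmono _ _ hj _ hk.1 hjk)⟩
  · obtain ⟨rfl, -⟩ : (t, j) = v ∧ _ := by
      simpa [Finsupp.single_apply] using h
    simpa using ⟨hjk.trans_lt hk'.1, hk'.2⟩

open Classical in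
/-- The variables of color `t` and position less than `N`. -/
noncomputable def block (S : Fin n → Set ℕ) (N : ℕ) (t : Fin n) : Finset (Fin n × ℕ) :=
  ((range N).filter (· ∈ S t)).image (Prod.mk t)

lemma mem_block {v : Fin n × ℕ} : v ∈ block S N t ↔ v.1 = t ∧ v.2 < N ∧ v.2 ∈ S t := by
  obtain ⟨i, j⟩ := v
  simp only [block, mem_image, mem_filter, mem_range, Prod.mk.injEq]
  constructor
  · rintro ⟨_, h, rfl, rfl⟩
    exact ⟨rfl, h⟩
  · rintro ⟨rfl, h⟩
    exact ⟨j, h, rfl, rfl⟩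

lemma injOn_snd_block : Set.InjOn Prod.snd (block S N t : Set (Fin n × ℕ)) := fun _ hv _ hw h =>
  Prod.ext ((mem_block.1 hv).1.trans (mem_block.1 hw).1.symm) h

lemma degOn_eq_sum_block (hp : p ≤ boxMon S e N D) : degOn t p = ∑ v ∈ block S N t, p v := by
  rw [le_boxMon_iff] at hp
  refine degOn_eq_sum (fun v hv => (mem_block.1 hv).1) fun v hv h => mem_block.2 ?_
  subst hv
  exact ⟨rfl, (hp.2 v h).1, (hp.1 v.1 v.2 h).1⟩

lemma degOn_eq_of_mem_fiber (hp : p ≤ boxMon S e N D)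
    (hq : q ∈ fiber (boxMon S e N D) (block S N t) p) (i : Fin n) : degOn i q = degOn i p := by
  rw [mem_fiber] at hq
  by_cases h : i = t
  · subst h
    rw [degOn_eq_sum_block hp, degOn_eq_sum_block hq.1, hq.2.2]
  · exact degOn_congr fun j => hq.2.1 _ fun hj => h (mem_block.1 hj).1

/-- A set of monomials fixed by the compression along every block is color-compressed. -/
lemma isColorCompressedM_of_compress_eq {M : Finset (MCMon n)} {B : ℕ}
    (hB : ∀ v, boxMon S e N D v < B) (hM : M ⊆ Iic (boxMon S e N D))
    (hD : ∀ m ∈ M, ∀ i, degOn i m ≤ D)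
    (hcomp : ∀ t, compress (boxMon S e N D) (wt B Prod.snd) (block S N t) M = M) :
    IsColorCompressedM S e (M : Set (MCMon n)) := by
  intro t m hm q ⟨hqt, hqb, hqd⟩ hlex p hpm hpq
  have hmu := mem_Iic.1 (hM hm)
  obtain ⟨hmb, hmN⟩ := le_boxMon_iff.1 hmu
  rw [totalDeg_eq_degOn hqt] at hqd
  have hdeg : degOn t p = degOn t m := (degOn_congr hpq).trans hqd
  have hqN : ∀ j, p (t, j) ≠ 0 → j < N := by
    intro j hj
    rw [hpq] at hj
    by_contra! hNj
    have hmz : ∀ k, N ≤ k → m (t, k) = 0 := fun k hk => by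
      by_contra h
      exact (hmN (t, k) h).1.not_ge hk
    rcases hlex with h | ⟨k, hk, hup⟩
    · exact hj ((h j).trans (hmz j hNj))
    · have hkN : k < N := by
        by_contra! h
        rw [hmz k h] at hk
        exact hk.not_ge (Nat.zero_le _)
      exact hj ((hup j (hkN.trans_le hNj)).trans (hmz j hNj))
  have hpu : p ≤ boxMon S e N D := by
    refine le_boxMon_iff.2 ⟨fun i j h => ?_, fun v h => ?_⟩
    · by_cases hi : i = t
      · subst hi
        rw [hpq] at h ⊢
        exact hqb i j h
      · rw [hpm _ hi] at h ⊢
        exact hmb i j h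
    · by_cases hi : v.1 = t
      · refine ⟨hqN v.2 (by rwa [← hi]), (le_degOn v p).trans ?_⟩
        rw [hi, hdeg]
        exact hD m hm t
      · rw [hpm _ hi] at h ⊢
        exact hmN v h
  have hoff : ∀ v ∉ block S N t, p v = m v := fun v hv => by
    by_cases hi : v.1 = t
    · have hz : ∀ r ≤ boxMon S e N D, r v = 0 := fun r hr => by
        by_contra h
        have hr := le_boxMon_iff.1 hr
        exact hv (mem_block.2 ⟨hi, (hr.2 v h).1, hi ▸ (hr.1 v.1 v.2 h).1⟩)
      rw [hz p hpu, hz m hmu]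
    · exact hpm v hi
  refine mem_of_compress_eq (hcomp t) hm (mem_fiber.2 ⟨hpu, hoff, ?_⟩) ?_
  · rw [← degOn_eq_sum_block hpu, ← degOn_eq_sum_block hmu, hdeg]
  · rcases hlex with h | ⟨j, hj, hup⟩
    · have : p = m := by
        ext v
        by_cases hi : v.1 = t
        · obtain ⟨i, j⟩ := v
          obtain rfl : i = t := hi
          rw [hpq, h]
        · exact hpm v hi
      rw [this]
    · rw [← hpq] at hj
      have hjb : (t, j) ∈ block S N t := by
        by_contra h
        exact hj.ne (hoff _ h)
      refine (wt_lt_of_lex injOn_snd_block (fun v => (hpu v).trans_lt (hB v)) hoff hjb hj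
        fun w hw hlt => ?_).le
      obtain ⟨i, k⟩ := w
      obtain rfl : i = t := (mem_block.1 hw).1
      rw [hpq]
      exact hup k hlt

end Box

/-- If all bound sequences are weakly decreasing, an array of
integers is the fine f-vector of a finite colored multicomplex of type `a` in
`𝓜_π(e₁,…,eₙ)` iff it is the fine f-vector of a color-compressed one. -/
theorem fineFVector_iff_colorCompressed {n : ℕ} (hn : 0 < n)
    (S : Fin n → Set ℕ) (hS : ∀ i, (S i).Nonempty)
    (e : Fin n → ℕ → ℕ∞) (he : ∀ i, ∀ j ∈ S i, 1 ≤ e i j)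
    (hmono : ∀ i, ∀ j ∈ S i, ∀ k ∈ S i, j ≤ k → e i k ≤ e i j)
    (a : Fin n → ℕ) (ha : ∀ i, 0 < a i) (f : (Fin n → ℕ) → ℤ) :
    (∃ M : Set (MCMon n), M.Finite ∧ IsMulticomplex M ∧
        (∀ m ∈ M, InBounds S e m) ∧ IsColoredType a M ∧ HasFineFVectorM a M f) ↔
      (∃ M : Set (MCMon n), M.Finite ∧ IsMulticomplex M ∧
        (∀ m ∈ M, InBounds S e m) ∧ IsColoredType a M ∧ IsColorCompressedM S e M ∧
        HasFineFVectorM a M f) := by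
  refine ⟨?_, fun ⟨M, h1, h2, h3, h4, _, h5⟩ => ⟨M, h1, h2, h3, h4, h5⟩⟩
  rintro ⟨M, hfin, ⟨hne, hdiv⟩, hbd, htype, hf⟩
  lift M to Finset (MCMon n) using hfin
  set D := ∑ i, a i
  have hD : ∀ i, a i ≤ D := fun i => single_le_sum (fun _ _ => Nat.zero_le _) (mem_univ i)
  set N := (M.biUnion Finsupp.support).sup Prod.snd + 1
  have hMu : M ⊆ Iic (boxMon S e N D) := fun m hm => mem_Iic.2 <| le_boxMon_iff.2
    ⟨hbd m hm, fun v hv => ⟨Nat.lt_succ_of_le (le_sup (f := Prod.snd) (mem_biUnion.2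
      ⟨m, hm, Finsupp.mem_support_iff.2 hv⟩)), (le_degOn v m).trans ((htype m hm _).trans (hD _))⟩⟩
  have hB : ∀ v, boxMon S e N D v < D + 2 := fun v => by
    have := boxMon_le (S := S) (e := e) (N := N) (D := D) v
    omega
  obtain ⟨M', hMu', hlow, hcomp, hcard⟩ := exists_isLowerSet_forall_compress_eq hB (by omega)
    (fun i => injOn_snd_block (S := S) (N := N) (t := i))
    (fun i v hv w hw hvw => by
      obtain ⟨_, j⟩ := v
      obtain ⟨_, k⟩ := w
      obtain ⟨rfl, -, hj⟩ := mem_block.1 hv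
      obtain ⟨rfl, -, -⟩ := mem_block.1 hw
      exact boxMon_anti hmono hj hvw)
    (fun m i => degOn i m)
    (fun t p hp q hq => funext fun i => degOn_eq_of_mem_fiber hp hq i) hMu
    fun m m' h hm => hdiv m hm m' h
  have hex : ∀ b, (∃ m ∈ M', (fun i => degOn i m) = b) ↔ ∃ m ∈ M, (fun i => degOn i m) = b :=
    fun b => by
      simpa only [card_pos, Finset.Nonempty, mem_filter] using
        (iff_of_eq (congrArg (0 < ·) (hcard b)))
  have htype' : IsColoredType a (M' : Set (MCMon n)) := fun m hm i => by
    obtain ⟨m₀, hm₀, h⟩ := (hex _).1 ⟨m, hm, rfl⟩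
    exact (congrFun h i).symm.trans_le (htype m₀ hm₀ i)
  have hne' : (M' : Set (MCMon n)).Nonempty := by
    obtain ⟨m, hm⟩ := hne
    obtain ⟨m', hm', -⟩ := (hex _).2 ⟨m, hm, rfl⟩
    exact ⟨m', hm'⟩
  refine ⟨M', M'.finite_toSet, ⟨hne', fun m hm m' h => hlow h hm⟩,
    fun m hm => (le_boxMon_iff.1 (mem_Iic.1 (hMu' hm))).1, htype',
    isColorCompressedM_of_compress_eq hB hMu' (fun m hm i => (htype' m hm i).trans (hD i)) hcomp,
    fun b hb => ?_⟩
  have hncard : ∀ L : Finset (MCMon n),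
      {m | m ∈ (L : Set (MCMon n)) ∧ ∀ i, degOn i m = b i}.ncard =
        #(L.filter fun m => (fun i => degOn i m) = b) := fun L => by
    rw [← Set.ncard_coe_finset]
    congr 1
    ext m
    simp [funext_iff]
  rw [hf b hb, hncard, hncard, hcard]
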